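/- arXiv:2510.16385 — 2 statements merged into one kernel-verified Lean document; each statement's English description precedes it below -/
import Mathlib

section
/- Let G=(V,E) be a finite simple undirected graph with preferences as described, assume P≠∅, and let x∈P. Let e={v,w} be an edge in E⁺. Then (E_x(v) is flat and E_x(v) ∼_v e) if and only if (E_x(w) is flat and E_x(w) ∼_w e). -/
/-!
Common setup: a finite simple undirected graph `G = (V, E)` where edges are
elements of `Sym2 V`, together with, for each vertex `v`, a complete and
transitive preference relation `pref v` on `E(v) ∪ {∅}` (the unmatched
option `∅` is encoded as `none : Option (Sym2 V)`), where every incident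
edge is strictly preferred to `∅`.
-/

/-- A roommates instance: a finite simple graph with preferences. -/
structure RSetup (V : Type*) [Fintype V] [DecidableEq V] where
  /-- the edge set -/
  E : Finset (Sym2 V)
  /-- the graph is simple: no loops -/
  not_diag : ∀ e ∈ E, ¬ e.IsDiag
  /-- the preference relation `≿ᵥ` of each vertex, on `E(v) ∪ {∅}` -/
  pref : V → Option (Sym2 V) → Option (Sym2 V) → Prop
  /-- completeness of `≿ᵥ` on `E(v) ∪ {∅}` -/
  pref_total : ∀ v : V, ∀ a b : Option (Sym2 V),
    (∀ e, a = some e → e ∈ E ∧ v ∈ e) → (∀ e, b = some e → e ∈ E ∧ v ∈ e) →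
    pref v a b ∨ pref v b a
  /-- transitivity of `≿ᵥ` on `E(v) ∪ {∅}` -/
  pref_trans : ∀ v : V, ∀ a b c : Option (Sym2 V),
    (∀ e, a = some e → e ∈ E ∧ v ∈ e) → (∀ e, b = some e → e ∈ E ∧ v ∈ e) →
    (∀ e, c = some e → e ∈ E ∧ v ∈ e) →
    pref v a b → pref v b c → pref v a c
  /-- every incident edge is strictly preferred to being unmatched -/
  pref_none : ∀ v : V, ∀ e ∈ E, v ∈ e →
    pref v (some e) none ∧ ¬ pref v none (some e)

namespace RSetup

variable {V : Type*} [Fintype V] [DecidableEq V] (S : RSetup V)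

/-- `a ≻ᵥ b` : strict preference. -/
def SPref (v : V) (a b : Option (Sym2 V)) : Prop :=
  S.pref v a b ∧ ¬ S.pref v b a

/-- `a ∼ᵥ b` : indifference. -/
def IPref (v : V) (a b : Option (Sym2 V)) : Prop :=
  S.pref v a b ∧ S.pref v b a

/-- `F(v)` : the set of edges in `F` incident to `v`. -/
def inc (F : Finset (Sym2 V)) (v : V) : Finset (Sym2 V) :=
  F.filter (fun e => v ∈ e)

/-- a matching in `G` -/
def IsMatching (μ : Finset (Sym2 V)) : Prop :=
  μ ⊆ S.E ∧ ∀ v : V, (inc μ v).card ≤ 1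

/-- `μ(v)` : the edge of `μ` incident to `v` (or `none`). -/
noncomputable def matchOf (μ : Finset (Sym2 V)) (v : V) : Option (Sym2 V) :=
  (inc μ v).toList.head?

/-- `e` blocks the matching `μ`. -/
def Blocks (μ : Finset (Sym2 V)) (e : Sym2 V) : Prop :=
  e ∈ S.E ∧ e ∉ μ ∧ (∀ v ∈ e, S.pref v (some e) (matchOf μ v)) ∧
    (∃ v ∈ e, S.SPref v (some e) (matchOf μ v))

/-- a strongly stable matching in `G` -/
def StronglyStable (μ : Finset (Sym2 V)) : Prop :=
  S.IsMatching μ ∧ ∀ e : Sym2 V, ¬ S.Blocks μ e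

/-- `x(W) = ∑_{e ∈ W} x(e)` -/
def xS (x : Sym2 V → ℝ) (W : Finset (Sym2 V)) : ℝ := ∑ e ∈ W, x e

/-- `x ∈ ℝ₊^E`, encoded as a nonnegative function on `Sym2 V` vanishing
outside `E`. -/
def IsVec (x : Sym2 V → ℝ) : Prop :=
  (∀ e, 0 ≤ x e) ∧ ∀ e ∉ S.E, x e = 0

open Classical in
/-- `E[∼ᵥ e] = {f ∈ E(v) : f ∼ᵥ e}` -/
noncomputable def simSet (v : V) (e : Sym2 V) : Finset (Sym2 V) :=
  (inc S.E v).filter (fun f => S.IPref v (some f) (some e))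

open Classical in
/-- `E[≻ᵥ e] = {f ∈ E(v) : f ≻ᵥ e}` -/
noncomputable def succSet (v : V) (e : Sym2 V) : Finset (Sym2 V) :=
  (inc S.E v).filter (fun f => S.SPref v (some f) (some e))

open Classical in
/-- `E⟨X⟩ = {e ∈ E : e ⊆ X}` -/
noncomputable def esub (X : Finset V) : Finset (Sym2 V) :=
  S.E.filter (fun e => ∀ u ∈ e, u ∈ X)

/-- constraint (1): `x(E(v)) ≤ 1` for every vertex `v` -/
def C1 (x : Sym2 V → ℝ) : Prop := ∀ v : V, xS x (inc S.E v) ≤ 1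

/-- constraint (2): `x(E[∼ᵥ e]) + ∑_{w ∈ e} x(E[≻_w e]) ≥ 1`
for every edge `e ∈ E` and `v ∈ e` -/
def C2 (x : Sym2 V → ℝ) : Prop := ∀ v w : V, s(v, w) ∈ S.E →
  xS x (S.simSet v s(v, w)) +
    (xS x (S.succSet v s(v, w)) + xS x (S.succSet w s(v, w))) ≥ 1

/-- constraint (3): `x(E⟨X⟩) ≤ ⌊|X|/2⌋` for every odd `X ⊆ V` -/
def C3 (x : Sym2 V → ℝ) : Prop := ∀ X : Finset V, Odd X.card →
  xS x (S.esub X) ≤ ((X.card / 2 : ℕ) : ℝ)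

/-- membership in the polytope `P` -/
def memP (x : Sym2 V → ℝ) : Prop := S.IsVec x ∧ S.C1 x ∧ S.C2 x ∧ S.C3 x

/-- the characteristic vector `χ_μ` of a set of edges -/
def chi (μ : Finset (Sym2 V)) : Sym2 V → ℝ := fun e => if e ∈ μ then 1 else 0

open Classical in
/-- `E_x = {e ∈ E : x(e) > 0}` -/
noncomputable def supp (x : Sym2 V → ℝ) : Finset (Sym2 V) :=
  S.E.filter (fun e => 0 < x e)

/-- `V₁` : the set of vertices `v` with `x(E(v)) > 0` for some `x ∈ P` -/
def V1 : Set V := {v : V | ∃ x : Sym2 V → ℝ, S.memP x ∧ 0 < xS x (inc S.E v)}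

open Classical in
/-- `B_x(v)` : the best edges in `E_x(v)` for `v` -/
noncomputable def Bset (x : Sym2 V → ℝ) (v : V) : Finset (Sym2 V) :=
  (inc (S.supp x) v).filter
    (fun e => ∀ f ∈ inc (S.supp x) v, S.pref v (some e) (some f))

open Classical in
/-- `W_x(v)` : the worst edges in `E_x(v)` for `v` -/
noncomputable def Wset (x : Sym2 V → ℝ) (v : V) : Finset (Sym2 V) :=
  (inc (S.supp x) v).filter
    (fun e => ∀ f ∈ inc (S.supp x) v, S.pref v (some f) (some e))

/-- a nonempty `F ⊆ E(v)` is flat if `v` is indifferent among its members -/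
def Flat (v : V) (F : Finset (Sym2 V)) : Prop :=
  F.Nonempty ∧ ∀ e ∈ F, ∀ f ∈ F, S.IPref v (some e) (some f)

open Classical in
/-- `T_x` : edges `e ∈ E⟨V₁⟩` such that, for each `v ∈ e`, either
`e ∈ B_x(v) ∪ W_x(v)` or `B_x(v) ≻ᵥ e ≻ᵥ W_x(v)`. -/
noncomputable def Tset (x : Sym2 V → ℝ) : Finset (Sym2 V) :=
  (S.E.filter (fun e => ∀ u ∈ e, u ∈ S.V1)).filter (fun e => ∀ v ∈ e,
    (e ∈ S.Bset x v ∪ S.Wset x v) ∨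
      ((∀ f ∈ S.Bset x v, S.SPref v (some f) (some e)) ∧
        (∀ f ∈ S.Wset x v, S.SPref v (some e) (some f))))

/-- membership in `P(F) = {x ∈ P : x(e) = 0 for all e ∈ E \ F}` -/
def memPF (F : Finset (Sym2 V)) (x : Sym2 V → ℝ) : Prop :=
  S.memP x ∧ ∀ e ∈ S.E, e ∉ F → x e = 0

open Classical in
/-- `E⁺ = {e ∈ E : e ∈ E_z for some z ∈ P}` -/
noncomputable def Eplus : Finset (Sym2 V) :=
  S.E.filter (fun e => ∃ z : Sym2 V → ℝ, S.memP z ∧ 0 < z e)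

open Classical in
/-- `P'` : given `x ∈ P` and a strongly stable matching `σ`, the set of
vertices `v ∈ V₁` with `W_x(v) ≻ᵥ σ(v)`, or with
`B_x(v) ≻ᵥ W_x(v)` and `W_x(v) ∼ᵥ σ(v)`. -/
def Pset (x : Sym2 V → ℝ) (σ : Finset (Sym2 V)) : Set V :=
  {v : V | v ∈ S.V1 ∧
    ((∀ f ∈ S.Wset x v, S.SPref v (some f) (matchOf σ v)) ∨
      ((∀ f ∈ S.Bset x v, ∀ g ∈ S.Wset x v, S.SPref v (some f) (some g)) ∧
        (∀ f ∈ S.Wset x v, S.IPref v (some f) (matchOf σ v))))}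

/-- `Q'` : given `x ∈ P` and a strongly stable matching `σ`, the set of
vertices `v ∈ V₁` with `σ(v) ≻ᵥ B_x(v)`, or with
`B_x(v) ≻ᵥ W_x(v)` and `B_x(v) ∼ᵥ σ(v)`. -/
def Qset (x : Sym2 V → ℝ) (σ : Finset (Sym2 V)) : Set V :=
  {v : V | v ∈ S.V1 ∧
    ((∀ f ∈ S.Bset x v, S.SPref v (matchOf σ v) (some f)) ∨
      ((∀ f ∈ S.Bset x v, ∀ g ∈ S.Wset x v, S.SPref v (some f) (some g)) ∧
        (∀ f ∈ S.Bset x v, S.IPref v (some f) (matchOf σ v))))}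

/-- `R'` : given `x ∈ P` and a strongly stable matching `σ`, the set of
vertices `v ∈ V₁` such that `E_x(v)` is flat and `E_x(v) ∼ᵥ σ(v)`. -/
def Rset (x : Sym2 V → ℝ) (σ : Finset (Sym2 V)) : Set V :=
  {v : V | v ∈ S.V1 ∧ S.Flat v (inc (S.supp x) v) ∧
    ∀ f ∈ inc (S.supp x) v, S.IPref v (some f) (matchOf σ v)}

end RSetup

namespace RSetup

variable {V : Type*} [Fintype V] [DecidableEq V] (S : RSetup V)

/-- Twice the `x`-weight that `v` strictly prefers to `e`, plus the `x`-weight tied with `e`. -/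
noncomputable def prefWeight (x : Sym2 V → ℝ) (v : V) (e : Sym2 V) : ℝ :=
  xS x (S.simSet v e) + 2 * xS x (S.succSet v e)

variable {S}

theorem pref_total_of_mem_inc {v : V} {e f : Sym2 V} (he : e ∈ inc S.E v) (hf : f ∈ inc S.E v) :
    S.pref v (some e) (some f) ∨ S.pref v (some f) (some e) :=
  S.pref_total v _ _ (by rintro _ ⟨⟩; exact Finset.mem_filter.1 he)
    (by rintro _ ⟨⟩; exact Finset.mem_filter.1 hf)

open Classical in
theorem prefWeight_eq_sum (x : Sym2 V → ℝ) (v : V) (e : Sym2 V) :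
    S.prefWeight x v e = ∑ f ∈ inc S.E v, x f *
      ((if S.IPref v (some f) (some e) then 1 else 0) +
        2 * (if S.SPref v (some f) (some e) then 1 else 0)) := by
  simp only [prefWeight, xS, simSet, succSet, Finset.sum_filter, Finset.mul_sum,
    ← Finset.sum_add_distrib]
  refine Finset.sum_congr rfl fun f _ => ?_
  split_ifs <;> ring

theorem sum_mul_prefWeight_add (x z : Sym2 V → ℝ) (v : V) :
    ∑ e ∈ inc S.E v, z e * S.prefWeight x v e + ∑ e ∈ inc S.E v, x e * S.prefWeight z v e =
      2 * (xS x (inc S.E v) * xS z (inc S.E v)) := by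
  classical
  simp only [prefWeight_eq_sum, xS]
  rw [Finset.sum_mul_sum]
  simp only [Finset.mul_sum]
  rw [Finset.sum_comm, ← Finset.sum_add_distrib]
  refine Finset.sum_congr rfl fun e he => ?_
  rw [← Finset.sum_add_distrib]
  refine Finset.sum_congr rfl fun f hf => ?_
  have := pref_total_of_mem_inc he hf
  by_cases h₁ : S.pref v (some e) (some f) <;> by_cases h₂ : S.pref v (some f) (some e) <;>
    simp_all [IPref, SPref] <;> ring

theorem sum_sum_inc (F : V → Sym2 V → ℝ) :
    ∑ v, ∑ e ∈ inc S.E v, F v e = ∑ e ∈ S.E, ∑ v with v ∈ e, F v e := by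
  simp only [inc, Finset.sum_filter]
  exact Finset.sum_comm

theorem sum_mem_edge {a b : V} (h : s(a, b) ∈ S.E) (F : V → ℝ) :
    ∑ v with v ∈ s(a, b), F v = F a + F b := by
  have hab : a ≠ b := fun h' => S.not_diag _ h (by simp [h'])
  rw [← Finset.sum_pair hab]
  congr 1
  ext v
  simp

theorem two_le_sum_prefWeight {x : Sym2 V → ℝ} (hx : S.C2 x) {e : Sym2 V} (he : e ∈ S.E) :
    2 ≤ ∑ v with v ∈ e, S.prefWeight x v e := by
  induction e with
  | _ a b =>
    have h₁ := hx a b he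
    have h₂ := hx b a (Sym2.eq_swap ▸ he)
    rw [Sym2.eq_swap (a := b)] at h₂
    rw [sum_mem_edge he]
    simp only [prefWeight]
    linarith

theorem sum_slack_eq (x z : Sym2 V → ℝ) :
    ∑ e ∈ S.E, z e * (∑ v with v ∈ e, S.prefWeight x v e - 2) =
      ∑ v, (∑ e ∈ inc S.E v, z e * S.prefWeight x v e - xS z (inc S.E v)) := by
  simp only [xS, ← Finset.sum_sub_distrib]
  rw [sum_sum_inc]
  refine Finset.sum_congr rfl fun e he => ?_
  induction e with
  | _ a b =>
    rw [sum_mem_edge he, sum_mem_edge he]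
    ring

theorem xS_nonneg {x : Sym2 V → ℝ} (hx : S.IsVec x) (W : Finset (Sym2 V)) : 0 ≤ xS x W :=
  Finset.sum_nonneg fun e _ => hx.1 e

theorem le_xS_inc {x : Sym2 V → ℝ} (hx : S.IsVec x) {v : V} {e : Sym2 V} (he : e ∈ inc S.E v) :
    x e ≤ xS x (inc S.E v) :=
  Finset.single_le_sum (fun f _ => hx.1 f) he

variable {x z : Sym2 V → ℝ}

theorem two_mul_xS_le (hx : S.memP x) (hz : S.memP z) (v : V) :
    2 * (xS x (inc S.E v) * xS z (inc S.E v)) ≤ xS x (inc S.E v) + xS z (inc S.E v) := by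
  nlinarith [xS_nonneg hx.1 (inc S.E v), xS_nonneg hz.1 (inc S.E v), hx.2.1 v, hz.2.1 v]

theorem slack_eq_zero (hx : S.memP x) (hz : S.memP z) :
    (∀ e ∈ S.E, z e * (∑ v with v ∈ e, S.prefWeight x v e - 2) = 0) ∧
      ∀ v, 2 * (xS x (inc S.E v) * xS z (inc S.E v)) =
        xS x (inc S.E v) + xS z (inc S.E v) := by
  have hnn {x z : Sym2 V → ℝ} (hx : S.memP x) (hz : S.memP z) (e : Sym2 V) (he : e ∈ S.E) :
      0 ≤ z e * (∑ v with v ∈ e, S.prefWeight x v e - 2) :=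
    mul_nonneg (hz.1.1 e) (sub_nonneg.2 (two_le_sum_prefWeight hx.2.2.1 he))
  have hle (v : V) (_ : v ∈ Finset.univ) := sub_nonneg.2 (two_mul_xS_le hx hz v)
  have hsum : ∑ e ∈ S.E, z e * (∑ v with v ∈ e, S.prefWeight x v e - 2) +
      ∑ e ∈ S.E, x e * (∑ v with v ∈ e, S.prefWeight z v e - 2) +
      ∑ v, (xS x (inc S.E v) + xS z (inc S.E v) -
        2 * (xS x (inc S.E v) * xS z (inc S.E v))) = 0 := by
    rw [sum_slack_eq, sum_slack_eq, ← Finset.sum_add_distrib, ← Finset.sum_add_distrib]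
    refine Finset.sum_eq_zero fun v _ => ?_
    linarith [sum_mul_prefWeight_add (S := S) x z v]
  have h₁ := Finset.sum_nonneg (hnn hx hz)
  have h₂ := Finset.sum_nonneg (hnn hz hx)
  have h₃ := Finset.sum_nonneg hle
  refine ⟨(Finset.sum_eq_zero_iff_of_nonneg (hnn hx hz)).1 (by linarith), fun v => ?_⟩
  have := (Finset.sum_eq_zero_iff_of_nonneg hle).1 (by linarith) v (Finset.mem_univ v)
  linarith

theorem xS_inc_eq_one (hx : S.memP x) (hz : S.memP z) {v : V} {e : Sym2 V}
    (he : e ∈ inc S.E v) (hze : 0 < z e) : xS x (inc S.E v) = 1 := by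
  have h := (slack_eq_zero hx hz).2 v
  have h₁ := le_xS_inc hz.1 he
  have h₂ := hx.2.1 v
  have h₃ := hz.2.1 v
  have h₄ := xS_nonneg hx.1 (inc S.E v)
  nlinarith

theorem xS_simSet_eq (hx : S.memP x) (hz : S.memP z) {v w : V} (he : s(v, w) ∈ S.E)
    (hze : 0 < z s(v, w)) : xS x (S.simSet v s(v, w)) = xS x (S.simSet w s(v, w)) := by
  have h := ((mul_eq_zero.1 ((slack_eq_zero hx hz).1 _ he)).resolve_left hze.ne')
  rw [sum_mem_edge he] at h
  simp only [prefWeight] at h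
  have h₁ := hx.2.2.1 v w he
  have h₂ := hx.2.2.1 w v (Sym2.eq_swap ▸ he)
  rw [Sym2.eq_swap (a := w)] at h₂
  linarith

theorem inc_supp_subset (x : Sym2 V → ℝ) (v : V) : inc (S.supp x) v ⊆ inc S.E v :=
  Finset.filter_subset_filter _ (Finset.filter_subset _ _)

theorem xS_inc_supp (hx : S.IsVec x) (v : V) : xS x (inc (S.supp x) v) = xS x (inc S.E v) := by
  refine Finset.sum_subset (inc_supp_subset x v) fun e he hne => ?_
  simp only [inc, supp, Finset.mem_filter] at he hne
  exact le_antisymm (not_lt.1 fun h => hne ⟨⟨he.1, h⟩, he.2⟩) (hx.1 e)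

theorem flat_and_sim_iff (hx : S.memP x) (hz : S.memP z) {v : V} {e : Sym2 V}
    (he : e ∈ inc S.E v) (hze : 0 < z e) :
    (S.Flat v (inc (S.supp x) v) ∧ ∀ f ∈ inc (S.supp x) v, S.IPref v (some f) (some e)) ↔
      xS x (S.simSet v e) = 1 := by
  classical
  have hone := xS_inc_eq_one hx hz he hze
  have hsub : S.simSet v e ⊆ inc S.E v := Finset.filter_subset _ _
  constructor
  · rintro ⟨-, h⟩
    refine le_antisymm (hone ▸ Finset.sum_le_sum_of_subset_of_nonneg hsub fun f _ _ => hx.1.1 f) ?_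
    rw [← hone, ← xS_inc_supp hx.1]
    exact Finset.sum_le_sum_of_subset_of_nonneg
      (fun f hf => Finset.mem_filter.2 ⟨inc_supp_subset x v hf, h f hf⟩) fun f _ _ => hx.1.1 f
  · intro h
    have hsim : ∀ f ∈ inc (S.supp x) v, S.IPref v (some f) (some e) := by
      intro f hf
      by_contra hne
      have hlt : xS x (S.simSet v e) < xS x (inc S.E v) :=
        Finset.sum_lt_sum_of_subset hsub (inc_supp_subset x v hf)
          (fun h => hne (Finset.mem_filter.1 h).2)
          (Finset.mem_filter.1 (Finset.mem_filter.1 hf).1).2 fun g _ _ => hx.1.1 g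
      linarith
    refine ⟨⟨?_, fun f hf g hg => ?_⟩, hsim⟩
    · by_contra hemp
      rw [← xS_inc_supp hx.1, Finset.not_nonempty_iff_eq_empty.1 hemp] at hone
      simp [xS] at hone
    · have key {a b : Sym2 V} (ha : a ∈ inc (S.supp x) v) (hb : b ∈ inc (S.supp x) v) :
          S.pref v (some a) (some b) :=
        S.pref_trans v _ (some e) _
          (by rintro _ ⟨⟩; exact Finset.mem_filter.1 (inc_supp_subset x v ha))
          (by rintro _ ⟨⟩; exact Finset.mem_filter.1 he)
          (by rintro _ ⟨⟩; exact Finset.mem_filter.1 (inc_supp_subset x v hb))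
          (hsim a ha).1 (hsim b hb).2
      exact ⟨key hf hg, key hg hf⟩

end RSetup

open RSetup in
/-- (A3) of Lemma 9: for `x ∈ P` and an edge
`e = {v, w} ∈ E⁺`, `E_x(v)` is flat with `E_x(v) ∼ᵥ e` iff `E_x(w)` is flat
with `E_x(w) ∼_w e`. -/
theorem flat_sim_iff_flat_sim
    {V : Type*} [Fintype V] [DecidableEq V] (S : RSetup V)
    (hP : ∃ y : Sym2 V → ℝ, S.memP y)
    (x : Sym2 V → ℝ) (hx : S.memP x)
    (v w : V) (he : s(v, w) ∈ S.Eplus) :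
    (S.Flat v (inc (S.supp x) v) ∧
        ∀ f ∈ inc (S.supp x) v, S.IPref v (some f) (some s(v, w))) ↔
      (S.Flat w (inc (S.supp x) w) ∧
        ∀ f ∈ inc (S.supp x) w, S.IPref w (some f) (some s(v, w))) := by
  classical
  obtain ⟨hE, z, hz, hze⟩ := Finset.mem_filter.1 he
  rw [flat_and_sim_iff hx hz (Finset.mem_filter.2 ⟨hE, Sym2.mem_mk_left v w⟩) hze,
    flat_and_sim_iff hx hz (Finset.mem_filter.2 ⟨hE, Sym2.mem_mk_right v w⟩) hze,
    xS_simSet_eq hx hz hE hze]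
end

section
/- Let G=(V,E) be a finite simple undirected graph with preferences as described, assume P≠∅, let x∈P, and let σ be a strongly stable matching in G. Let e={v,w} be an edge of σ. Then v ∈ P' if and only if w ∈ Q'. -/
/-- Characterization of "the minimum of `r` on `F` exceeds `t`, or `r` is not constant on `F` and
its minimum is `t`". -/
theorem Finset.argmin_gt_or_eq_iff {α β : Type*} [LinearOrder β] {F B W : Finset α}
    (hF : F.Nonempty) (r : α → β) (t : β)
    (hB : ∀ e, e ∈ B ↔ e ∈ F ∧ ∀ f ∈ F, r f ≤ r e)
    (hW : ∀ e, e ∈ W ↔ e ∈ F ∧ ∀ f ∈ F, r e ≤ r f) :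
    ((∀ f ∈ W, t < r f) ∨ ((∀ f ∈ B, ∀ g ∈ W, r g < r f) ∧ ∀ f ∈ W, r f = t)) ↔
      (∀ f ∈ F, t ≤ r f) ∧ ∃ f ∈ F, t < r f := by
  obtain ⟨b, hbF, hb⟩ := F.exists_max_image r hF
  obtain ⟨c, hcF, hc⟩ := F.exists_min_image r hF
  have hbB : b ∈ B := (hB b).2 ⟨hbF, hb⟩
  have hcW : c ∈ W := (hW c).2 ⟨hcF, hc⟩
  constructor
  · rintro (h | ⟨h, h'⟩)
    · exact ⟨fun f hf => (h c hcW).le.trans (hc f hf), c, hcF, h c hcW⟩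
    · have h1 := h b hbB c hcW
      have h2 := h' c hcW
      exact ⟨fun f hf => h2 ▸ hc f hf, b, hbF, h2 ▸ h1⟩
  · rintro ⟨h, f, hf, hlt⟩
    rcases (h c hcF).lt_or_eq with hlt' | heq
    · exact Or.inl fun g hg => hlt'.trans_le (hc g ((hW g).1 hg).1)
    · have hWt : ∀ g ∈ W, r g = t := fun g hg =>
        le_antisymm (heq ▸ ((hW g).1 hg).2 c hcF) (h g ((hW g).1 hg).1)
      exact Or.inr ⟨fun g hg k hk =>
        hWt k hk ▸ hlt.trans_le (((hB g).1 hg).2 f hf), hWt⟩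

namespace RSetup

variable {V : Type*} [Fintype V] [DecidableEq V] {S : RSetup V}

/-- Each preference relation is represented by a utility function. -/
theorem exists_rank (S : RSetup V) (v : V) : ∃ r : Option (Sym2 V) → ℕ, ∀ a b : Option (Sym2 V),
    (∀ e, a = some e → e ∈ S.E ∧ v ∈ e) → (∀ e, b = some e → e ∈ S.E ∧ v ∈ e) →
    (S.pref v a b ↔ r b ≤ r a) := by
  classical
  refine ⟨fun a => (Finset.univ.filter fun c : Option (Sym2 V) =>
    (∀ e, c = some e → e ∈ S.E ∧ v ∈ e) ∧ S.pref v a c).card, fun a b ha hb => ?_⟩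
  have refl : ∀ c : Option (Sym2 V), (∀ e, c = some e → e ∈ S.E ∧ v ∈ e) → S.pref v c c :=
    fun c hc => (S.pref_total v c c hc hc).elim id id
  constructor
  · intro hab
    refine Finset.card_le_card fun c hc => ?_
    simp only [Finset.mem_filter, Finset.mem_univ, true_and] at hc ⊢
    exact ⟨hc.1, S.pref_trans v a b c ha hb hc.1 hab hc.2⟩
  · intro hle
    by_contra hab
    have hba := (S.pref_total v a b ha hb).resolve_left hab
    refine absurd hle (not_le.2 (Finset.card_lt_card ((Finset.ssubset_iff_of_subset ?_).2
      ⟨b, ?_, ?_⟩)))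
    · intro c hc
      simp only [Finset.mem_filter, Finset.mem_univ, true_and] at hc ⊢
      exact ⟨hc.1, S.pref_trans v b a c hb ha hc.1 hba hc.2⟩
    · simpa using ⟨hb, refl b hb⟩
    · simpa using fun _ => hab

omit [Fintype V] in
theorem mem_of_matchOf_eq_some {μ : Finset (Sym2 V)} {v : V} {e : Sym2 V}
    (h : matchOf μ v = some e) : e ∈ μ ∧ v ∈ e := by
  have := List.mem_of_head? h
  simpa [inc] using this

omit [Fintype V] in
theorem matchOf_eq_some {μ : Finset (Sym2 V)} {v : V} {e : Sym2 V}
    (hμ : (inc μ v).card ≤ 1) (he : e ∈ μ) (hv : v ∈ e) : matchOf μ v = some e := by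
  have hmem : e ∈ inc μ v := by simp [inc, he, hv]
  have : inc μ v = {e} :=
    Finset.eq_singleton_iff_unique_mem.2 ⟨hmem, fun f hf => Finset.card_le_one.1 hμ f hf e hmem⟩
  simp [matchOf, this]

theorem sum_inc_comm (F : Finset (Sym2 V)) (g : Sym2 V → V → ℝ) :
    ∑ u, ∑ f ∈ inc F u, g f u = ∑ f ∈ F, ∑ u with u ∈ f, g f u := by
  simp only [inc, Finset.sum_filter]
  exact Finset.sum_comm

theorem sum_endpoints {v w : V} (h : v ≠ w) (g : V → ℝ) :
    ∑ u with u ∈ s(v, w), g u = g v + g w := by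
  have : (Finset.univ.filter fun u => u ∈ s(v, w)) = {v, w} := by ext; simp
  rw [this, Finset.sum_pair h]

open Classical in
/-- The weight of the edges that `v` weakly prefers to `σ(v)`. -/
noncomputable def weakWeight (S : RSetup V) (x : Sym2 V → ℝ) (σ : Finset (Sym2 V)) (v : V) : ℝ :=
  ∑ f ∈ inc S.E v, if S.pref v (some f) (matchOf σ v) then x f else 0

open Classical in
/-- The weight of the edges that `v` strictly prefers to `σ(v)`. -/
noncomputable def strictWeight (S : RSetup V) (x : Sym2 V → ℝ) (σ : Finset (Sym2 V)) (v : V) : ℝ :=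
  ∑ f ∈ inc S.E v, if S.SPref v (some f) (matchOf σ v) then x f else 0

theorem one_le_weakWeight_add_strictWeight {x : Sym2 V → ℝ} {σ : Finset (Sym2 V)} (hx : S.C2 x)
    (hσ : S.IsMatching σ) {v w : V} (he : s(v, w) ∈ σ) :
    1 ≤ S.weakWeight x σ v + S.strictWeight x σ w := by
  have hv : matchOf σ v = some s(v, w) := matchOf_eq_some (hσ.2 v) he (by simp)
  have hw : matchOf σ w = some s(v, w) := matchOf_eq_some (hσ.2 w) he (by simp)
  have h := hx v w (hσ.1 he)
  have hsplit : S.weakWeight x σ v =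
      xS x (S.simSet v s(v, w)) + xS x (S.succSet v s(v, w)) := by
    simp only [weakWeight, xS, simSet, succSet, Finset.sum_filter, ← Finset.sum_add_distrib]
    refine Finset.sum_congr rfl fun f _ => ?_
    by_cases h1 : S.pref v (some f) (some s(v, w)) <;>
      by_cases h2 : S.pref v (some s(v, w)) (some f) <;> simp [SPref, IPref, hv, h1, h2]
  have hstrict : S.strictWeight x σ w = xS x (S.succSet w s(v, w)) := by
    simp only [strictWeight, xS, succSet, Finset.sum_filter]
    refine Finset.sum_congr rfl fun f _ => ?_
    by_cases h1 : S.SPref w (some f) (some s(v, w)) <;> simp [hw, h1]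
  linarith

theorem StronglyStable.not_blocks_pair {σ : Finset (Sym2 V)} (hσ : S.StronglyStable σ) {v w : V}
    (hE : s(v, w) ∈ S.E) :
    ¬ (S.pref v (some s(v, w)) (matchOf σ v) ∧ S.pref w (some s(v, w)) (matchOf σ w) ∧
      (S.SPref v (some s(v, w)) (matchOf σ v) ∨ S.SPref w (some s(v, w)) (matchOf σ w))) := by
  rintro ⟨h1, h2, h3⟩
  by_cases hmem : s(v, w) ∈ σ
  · rw [matchOf_eq_some (hσ.1.2 v) hmem (by simp), matchOf_eq_some (hσ.1.2 w) hmem (by simp)] at h3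
    rcases h3 with h | h <;> exact h.2 h.1
  · refine hσ.2 _ ⟨hE, hmem, by simpa using ⟨h1, h2⟩, ?_⟩
    rcases h3 with h | h
    · exact ⟨v, by simp, h⟩
    · exact ⟨w, by simp, h⟩

theorem sum_weights_le {x : Sym2 V → ℝ} {σ : Finset (Sym2 V)} (hx : S.IsVec x)
    (hσ : S.StronglyStable σ) :
    ∑ u, (S.weakWeight x σ u + S.strictWeight x σ u) ≤ ∑ u, xS x (inc S.E u) := by
  simp only [weakWeight, strictWeight, xS, ← Finset.sum_add_distrib]
  rw [sum_inc_comm S.E fun f _ => x f, sum_inc_comm S.E fun f u => _]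
  refine Finset.sum_le_sum fun f hf => ?_
  induction f using Sym2.ind with
  | _ v w =>
    have hne : v ≠ w := fun h => S.not_diag _ hf (by simpa using h)
    have hnb := hσ.not_blocks_pair hf
    have h0 := hx.1 s(v, w)
    rw [sum_endpoints hne, sum_endpoints hne]
    by_cases h1 : S.pref v (some s(v, w)) (matchOf σ v) <;>
    by_cases h2 : S.pref w (some s(v, w)) (matchOf σ w) <;>
    by_cases h3 : S.pref v (matchOf σ v) (some s(v, w)) <;>
    by_cases h4 : S.pref w (matchOf σ w) (some s(v, w)) <;>
    simp_all [SPref]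

/-- Every inequality involved in comparing `x` with a strongly stable matching is tight. -/
theorem tight_of_mem_matching {x : Sym2 V → ℝ} {σ : Finset (Sym2 V)} (hx : S.memP x)
    (hσ : S.StronglyStable σ) {v w : V} (he : s(v, w) ∈ σ) :
    xS x (inc S.E v) = 1 ∧ S.weakWeight x σ v + S.strictWeight x σ w = 1 := by
  obtain ⟨hvec, h1, h2, -⟩ := hx
  set k : V → ℝ := fun u => S.weakWeight x σ u + S.strictWeight x σ u - 1 with hk
  have hedge : ∀ a b, s(a, b) ∈ σ → ∑ u with u ∈ s(a, b), k u =
      (S.weakWeight x σ a + S.strictWeight x σ b - 1) +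
        (S.weakWeight x σ b + S.strictWeight x σ a - 1) := by
    intro a b hab
    rw [sum_endpoints fun h => S.not_diag _ (hσ.1.1 hab) (by simpa using h)]
    ring
  have hpair : ∀ a b, s(a, b) ∈ σ → 1 ≤ S.weakWeight x σ a + S.strictWeight x σ b :=
    fun a b hab => one_le_weakWeight_add_strictWeight h2 hσ.1 hab
  have hedge_nonneg : ∀ f ∈ σ, 0 ≤ ∑ u with u ∈ f, k u := by
    intro f hf
    induction f using Sym2.ind with
    | _ a b =>
      rw [hedge a b hf]
      linarith [hpair a b hf, hpair b a (Sym2.eq_swap ▸ hf)]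
  have hvertex : ∀ u, xS x (inc S.E u) - (S.weakWeight x σ u + S.strictWeight x σ u) ≤
      -∑ _f ∈ inc σ u, k u := by
    intro u
    rcases Nat.le_one_iff_eq_zero_or_eq_one.1 (hσ.1.2 u) with hc | hc
    · have hempty : inc σ u = ∅ := Finset.card_eq_zero.1 hc
      have hnone : matchOf σ u = none := by simp [matchOf, hempty]
      have hweak : S.weakWeight x σ u = xS x (inc S.E u) := by
        refine Finset.sum_congr rfl fun f hf => if_pos ?_
        obtain ⟨hfE, hfu⟩ := Finset.mem_filter.1 hf
        exact hnone ▸ (S.pref_none u f hfE hfu).1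
      have hstrict : 0 ≤ S.strictWeight x σ u :=
        Finset.sum_nonneg fun f _ => by split_ifs <;> simp [hvec.1 f]
      simp [hempty, hweak, hstrict]
    · rw [Finset.sum_const, hc, one_smul]
      linarith [h1 u]
  have hcomm : ∑ u, ∑ _f ∈ inc σ u, k u = ∑ f ∈ σ, ∑ u with u ∈ f, k u :=
    sum_inc_comm σ fun _ u => k u
  have hσ_nonneg : 0 ≤ ∑ f ∈ σ, ∑ u with u ∈ f, k u := Finset.sum_nonneg hedge_nonneg
  have hle := sum_weights_le hvec hσ
  have hsum := Finset.sum_le_sum fun u (_ : u ∈ Finset.univ) => hvertex u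
  rw [Finset.sum_sub_distrib, Finset.sum_neg_distrib, hcomm] at hsum
  have hzero : ∑ f ∈ σ, ∑ u with u ∈ f, k u = 0 := by linarith
  have hvertex_eq := (Finset.sum_eq_sum_iff_of_le fun u _ => hvertex u).1 (by
    rw [Finset.sum_sub_distrib, Finset.sum_neg_distrib, hcomm]; linarith) v (Finset.mem_univ v)
  have hedge_eq := (Finset.sum_eq_zero_iff_of_nonneg hedge_nonneg).1 hzero _ he
  rw [hedge v w he] at hedge_eq
  have hinc : (inc σ v).card = 1 := le_antisymm (hσ.1.2 v)
    (Finset.card_pos.2 ⟨s(v, w), by simp [inc, he]⟩)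
  rw [Finset.sum_const, hinc, one_smul] at hvertex_eq
  constructor
  · linarith
  · linarith [hpair v w he, hpair w v (Sym2.eq_swap ▸ he)]

theorem mem_inc_supp {x : Sym2 V → ℝ} {v : V} {f : Sym2 V} :
    f ∈ inc (S.supp x) v ↔ f ∈ inc S.E v ∧ 0 < x f := by
  simp only [inc, supp, Finset.mem_filter]
  tauto

theorem sum_ite_pos_iff {x : Sym2 V → ℝ} (hx : S.IsVec x) (v : V) (p : Sym2 V → Prop)
    [DecidablePred p] :
    0 < (∑ f ∈ inc S.E v, if p f then x f else 0) ↔ ∃ f ∈ inc (S.supp x) v, p f := by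
  rw [Finset.sum_pos_iff_of_nonneg fun f _ => by split_ifs <;> simp [hx.1 f]]
  refine exists_congr fun f => ?_
  rw [mem_inc_supp]
  by_cases hp : p f <;> simp [hp]

theorem strictWeight_pos_iff {x : Sym2 V → ℝ} (hx : S.IsVec x) (σ : Finset (Sym2 V)) (v : V) :
    0 < S.strictWeight x σ v ↔
      ∃ f ∈ inc (S.supp x) v, S.SPref v (some f) (matchOf σ v) := by
  classical
  exact sum_ite_pos_iff hx v _

theorem weakWeight_lt_iff {x : Sym2 V → ℝ} (hx : S.IsVec x) (σ : Finset (Sym2 V)) (v : V) :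
    S.weakWeight x σ v < xS x (inc S.E v) ↔
      ∃ f ∈ inc (S.supp x) v, ¬ S.pref v (some f) (matchOf σ v) := by
  classical
  rw [← sum_ite_pos_iff hx v, ← sub_pos, xS, weakWeight, ← Finset.sum_sub_distrib]
  refine iff_of_eq (congrArg _ (Finset.sum_congr rfl fun f _ => ?_))
  split_ifs <;> simp

theorem inc_supp_nonempty {x : Sym2 V → ℝ} {v : V} (h : 0 < xS x (inc S.E v)) :
    (inc (S.supp x) v).Nonempty := by
  obtain ⟨f, hf, hpos⟩ := Finset.exists_lt_of_sum_lt
    (show ∑ _f ∈ inc S.E v, (0 : ℝ) < ∑ f ∈ inc S.E v, x f by simpa [xS] using h)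
  exact ⟨f, mem_inc_supp.2 ⟨hf, hpos⟩⟩

/-- A utility function for `v` on the edges of the support of `x` and on `σ(v)`, together with the
resulting descriptions of `B_x(v)` and `W_x(v)`. -/
theorem exists_rank_supp (S : RSetup V) (x : Sym2 V → ℝ) {σ : Finset (Sym2 V)} (hσ : σ ⊆ S.E)
    (v : V) : ∃ (r : Sym2 V → ℕ) (t : ℕ),
      (∀ e ∈ inc (S.supp x) v, ∀ f ∈ inc (S.supp x) v,
        (S.SPref v (some e) (some f) ↔ r f < r e)) ∧
      (∀ e ∈ inc (S.supp x) v, (S.pref v (some e) (matchOf σ v) ↔ t ≤ r e) ∧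
        (S.SPref v (some e) (matchOf σ v) ↔ t < r e) ∧
        (S.SPref v (matchOf σ v) (some e) ↔ r e < t) ∧
        (S.IPref v (some e) (matchOf σ v) ↔ r e = t)) ∧
      (∀ e, e ∈ S.Bset x v ↔ e ∈ inc (S.supp x) v ∧ ∀ f ∈ inc (S.supp x) v, r f ≤ r e) ∧
      (∀ e, e ∈ S.Wset x v ↔ e ∈ inc (S.supp x) v ∧ ∀ f ∈ inc (S.supp x) v, r e ≤ r f) := by
  obtain ⟨r, hr⟩ := S.exists_rank v
  have hsupp : ∀ e ∈ inc (S.supp x) v, ∀ f, some e = some f → f ∈ S.E ∧ v ∈ f := by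
    rintro e he _ ⟨⟩
    exact Finset.mem_filter.1 (mem_inc_supp.1 he).1
  have hmatch : ∀ f, matchOf σ v = some f → f ∈ S.E ∧ v ∈ f := fun f hf =>
    (mem_of_matchOf_eq_some hf).imp_left fun h => hσ h
  have hpair : ∀ e ∈ inc (S.supp x) v, ∀ f ∈ inc (S.supp x) v,
      (S.pref v (some e) (some f) ↔ r (some f) ≤ r (some e)) :=
    fun e he f hf => hr _ _ (hsupp e he) (hsupp f hf)
  refine ⟨fun e => r (some e), r (matchOf σ v), fun e he f hf => ?_, fun e he => ?_,
    fun e => ?_, fun e => ?_⟩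
  · rw [SPref, hpair e he f hf, hpair f hf e he, not_le]
    exact and_iff_right_of_imp le_of_lt
  · simp only [SPref, IPref, hr _ _ (hsupp e he) hmatch, hr _ _ hmatch (hsupp e he), true_and]
    refine ⟨?_, ?_, ?_⟩ <;> omega
  · simp only [Bset, Finset.mem_filter]
    exact and_congr_right fun he => forall₂_congr fun f hf => hpair e he f hf
  · simp only [Wset, Finset.mem_filter]
    exact and_congr_right fun he => forall₂_congr fun f hf => hpair f hf e he

theorem mem_Pset_iff {x : Sym2 V → ℝ} {σ : Finset (Sym2 V)} {v : V} (hx : S.memP x)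
    (hσ : σ ⊆ S.E) (hv : 0 < xS x (inc S.E v)) :
    v ∈ S.Pset x σ ↔ ¬ S.weakWeight x σ v < xS x (inc S.E v) ∧ 0 < S.strictWeight x σ v := by
  obtain ⟨r, t, hpair, hmatch, hB, hW⟩ := S.exists_rank_supp x hσ v
  have hBF : ∀ f ∈ S.Bset x v, f ∈ inc (S.supp x) v := fun f hf => ((hB f).1 hf).1
  have hWF : ∀ f ∈ S.Wset x v, f ∈ inc (S.supp x) v := fun f hf => ((hW f).1 hf).1
  rw [weakWeight_lt_iff hx.1, strictWeight_pos_iff hx.1]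
  push Not
  refine (and_iff_right ⟨x, hx, hv⟩).trans (Iff.trans ?_
    ((Finset.argmin_gt_or_eq_iff (inc_supp_nonempty hv) r t hB hW).trans ?_))
  · exact or_congr (forall₂_congr fun f hf => (hmatch f (hWF f hf)).2.1)
      (and_congr (forall₂_congr fun f hf => forall₂_congr fun g hg =>
        hpair f (hBF f hf) g (hWF g hg)) (forall₂_congr fun f hf => (hmatch f (hWF f hf)).2.2.2))
  · exact and_congr (forall₂_congr fun f hf => (hmatch f hf).1.symm)
      (exists_congr fun f => and_congr_right fun hf => (hmatch f hf).2.1.symm)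

theorem mem_Qset_iff {x : Sym2 V → ℝ} {σ : Finset (Sym2 V)} {v : V} (hx : S.memP x)
    (hσ : σ ⊆ S.E) (hv : 0 < xS x (inc S.E v)) :
    v ∈ S.Qset x σ ↔ ¬ 0 < S.strictWeight x σ v ∧ S.weakWeight x σ v < xS x (inc S.E v) := by
  obtain ⟨r, t, hpair, hmatch, hB, hW⟩ := S.exists_rank_supp x hσ v
  have hBF : ∀ f ∈ S.Bset x v, f ∈ inc (S.supp x) v := fun f hf => ((hB f).1 hf).1
  have hWF : ∀ f ∈ S.Wset x v, f ∈ inc (S.supp x) v := fun f hf => ((hW f).1 hf).1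
  rw [weakWeight_lt_iff hx.1, strictWeight_pos_iff hx.1]
  push Not
  refine (and_iff_right ⟨x, hx, hv⟩).trans (Iff.trans ?_
    ((Finset.argmin_gt_or_eq_iff (inc_supp_nonempty hv) (fun f => OrderDual.toDual (r f))
      (OrderDual.toDual t) hW hB).trans ?_))
  · exact or_congr (forall₂_congr fun f hf => (hmatch f (hBF f hf)).2.2.1)
      (and_congr ⟨fun h g hg f hf => (hpair f (hBF f hf) g (hWF g hg)).1 (h f hf g hg),
        fun h f hf g hg => (hpair f (hBF f hf) g (hWF g hg)).2 (h g hg f hf)⟩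
        (forall₂_congr fun f hf => (hmatch f (hBF f hf)).2.2.2))
  · exact and_congr (forall₂_congr fun f hf => by
        rw [(hmatch f hf).2.1, not_lt, OrderDual.toDual_le_toDual])
      (exists_congr fun f => and_congr_right fun hf => by
        rw [(hmatch f hf).1, not_le, OrderDual.toDual_lt_toDual])

end RSetup

open RSetup in
/-- (B1) of Lemma 10: for `x ∈ P`, a strongly stable matching
`σ`, and an edge `e = {v, w} ∈ σ`, `v ∈ P'` iff `w ∈ Q'`. -/
theorem mem_Pset_iff_mem_Qset
    {V : Type*} [Fintype V] [DecidableEq V] (S : RSetup V)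
    (hP : ∃ y : Sym2 V → ℝ, S.memP y)
    (x : Sym2 V → ℝ) (hx : S.memP x)
    (σ : Finset (Sym2 V)) (hσ : S.StronglyStable σ)
    (v w : V) (he : s(v, w) ∈ σ) :
    v ∈ S.Pset x σ ↔ w ∈ S.Qset x σ := by
  have he' : s(w, v) ∈ σ := Sym2.eq_swap ▸ he
  obtain ⟨hv, hvw⟩ := tight_of_mem_matching hx hσ he
  obtain ⟨hw, hwv⟩ := tight_of_mem_matching hx hσ he'
  rw [mem_Pset_iff hx hσ.1.1 (by simp [hv]), mem_Qset_iff hx hσ.1.1 (by simp [hw]), hv, hw]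
  constructor <;> rintro ⟨h1, h2⟩ <;> constructor <;> linarith
end
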